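/- Let d ≥ 1 and let M be the uncentered maximal operator on (ℝ^d, ‖·‖_∞) associated to ℓ∞ balls, acting on Lipschitz functions with respect to the ℓ∞ norm. Define h_d(s) = d/(d+1) − (1/(d+1))(s − 2^d s^{d+1}/(1+s)^d). Then the polynomial equation 2^d s^{d+1} − (1+s)^{d+1} + 2^d (d+1) s^d = 0 has a unique solution s_d in the open interval (0,1), and ‖M‖_{Op(1)} = h_d(s_d). -/

import Mathlib

open MeasureTheory Set Filter Topology

/-- The closed ball of the norm-like function `N`, with center `c` and radius `R`. -/
def nball {d : ℕ} (N : (Fin d → ℝ) → ℝ) (c : Fin d → ℝ) (R : ℝ) : Set (Fin d → ℝ) :=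
  {y | N (y - c) ≤ R}

/-- The uncentered Hardy–Littlewood maximal function associated to the norm `N`,
with respect to `d`-dimensional Lebesgue measure. -/
noncomputable def maxFn {d : ℕ} (N : (Fin d → ℝ) → ℝ) (f : (Fin d → ℝ) → ℝ)
    (x : Fin d → ℝ) : ℝ :=
  sSup {a : ℝ | ∃ c : Fin d → ℝ, ∃ R : ℝ, 0 < R ∧ x ∈ nball N c R ∧
    a = ⨍ y in nball N c R, |f y|}

/-- The modulus of continuity of `g`, with distances measured using `N`. -/
noncomputable def modCont {d : ℕ} (N : (Fin d → ℝ) → ℝ) (g : (Fin d → ℝ) → ℝ) (δ : ℝ) : ℝ :=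
  sSup {a : ℝ | ∃ x y : Fin d → ℝ, N (x - y) ≤ δ ∧ a = |g x - g y|}

/-- `N` is a norm on `ℝ^d`. -/
structure IsNorm {d : ℕ} (N : (Fin d → ℝ) → ℝ) : Prop where
  eq_zero_iff : ∀ x, N x = 0 ↔ x = 0
  add_le : ∀ x y, N (x + y) ≤ N x + N y
  smul : ∀ (a : ℝ) (x), N (a • x) = |a| * N x

/-- `ω` is a modulus of continuity: continuous, nondecreasing, subadditive on `[0,∞)`,
vanishing at `0`, nonnegative, and not identically zero. -/
structure IsModulus (ω : ℝ → ℝ) : Prop where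
  nonneg : ∀ t, 0 ≤ t → 0 ≤ ω t
  map_zero : ω 0 = 0
  mono : MonotoneOn ω (Ici 0)
  subadd : ∀ a b, 0 ≤ a → 0 ≤ b → ω (a + b) ≤ ω a + ω b
  cont : ContinuousOn ω (Ici 0)
  nontrivial : ∃ t, 0 < t ∧ ω t ≠ 0

/-- The `Lip(ω)` seminorm of `f`: `sup_{t>0} ω(f,t)/ω(t)`. -/
noncomputable def lipNorm {d : ℕ} (N : (Fin d → ℝ) → ℝ) (ω : ℝ → ℝ)
    (f : (Fin d → ℝ) → ℝ) : ℝ :=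
  sSup {a : ℝ | ∃ t : ℝ, 0 < t ∧ a = modCont N f t / ω t}

/-- The operator norm of the uncentered maximal operator on `Lip(ω)`. -/
noncomputable def opNorm (d : ℕ) (N : (Fin d → ℝ) → ℝ) (ω : ℝ → ℝ) : ℝ :=
  sSup {a : ℝ | ∃ f : (Fin d → ℝ) → ℝ, lipNorm N ω f = 1 ∧ a = lipNorm N ω (maxFn N f)}

/-- The Hölder `α` seminorm of `f`, distances measured with `N`. -/
noncomputable def holderNorm {d : ℕ} (N : (Fin d → ℝ) → ℝ) (α : ℝ)
    (f : (Fin d → ℝ) → ℝ) : ℝ :=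
  sSup {a : ℝ | ∃ x y : Fin d → ℝ, x ≠ y ∧ a = |f x - f y| / N (x - y) ^ α}

/-- The operator norm of the uncentered maximal operator on the Hölder class `Lip_α`. -/
noncomputable def opNormHolder (d : ℕ) (N : (Fin d → ℝ) → ℝ) (α : ℝ) : ℝ :=
  sSup {a : ℝ | ∃ f : (Fin d → ℝ) → ℝ, holderNorm N α f = 1 ∧
    a = holderNorm N α (maxFn N f)}

section Polynomial

theorem add_one_mul_pow_mul_le (n : ℕ) {w t : ℝ} (hw : 0 ≤ w) (ht : 0 < t) :
    ((n : ℝ) + 1) * t ^ n * w ≤ w ^ (n + 1) + n * t ^ (n + 1) := by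
  have h := one_add_mul_sub_le_pow (a := w / t) (by linarith [div_nonneg hw ht.le]) (n + 1)
  rw [div_pow, le_div_iff₀ (by positivity)] at h
  have e : (1 + ((n + 1 : ℕ) : ℝ) * (w / t - 1)) * t ^ (n + 1)
      = (n + 1) * t ^ n * w - n * t ^ (n + 1) := by
    push_cast
    field_simp
    ring
  linarith

theorem strictMonoOn_add_one_mul_pow_sub (d : ℕ) (hd : 1 ≤ d) :
    StrictMonoOn (fun t : ℝ => ((d : ℝ) + 1) * t ^ d - d * t ^ (d + 1)) (Icc 0 1) := by
  apply strictMonoOn_of_deriv_pos (convex_Icc 0 1) (by fun_prop)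
  intro t ht
  rw [interior_Icc] at ht
  have hder : HasDerivAt (fun t : ℝ => ((d : ℝ) + 1) * t ^ d - d * t ^ (d + 1))
      (((d : ℝ) + 1) * (d * t ^ (d - 1)) - d * (((d + 1 : ℕ) : ℝ) * t ^ d)) t :=
    ((hasDerivAt_pow d t).const_mul _).sub ((hasDerivAt_pow (d + 1) t).const_mul _)
  rw [hder.deriv]
  obtain ⟨k, rfl⟩ : ∃ k, d = k + 1 := ⟨d - 1, by omega⟩
  have : 0 < t ^ k * (1 - t) := mul_pos (pow_pos ht.1 _) (by linarith [ht.2])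
  have e : ((((k + 1 : ℕ) : ℝ)) + 1) * (((k + 1 : ℕ) : ℝ) * t ^ (k + 1 - 1))
      - ((k + 1 : ℕ) : ℝ) * (((k + 1 + 1 : ℕ) : ℝ) * t ^ (k + 1))
      = ((k : ℝ) + 1) * (k + 2) * (t ^ k * (1 - t)) := by
    push_cast
    ring
  rw [e]
  positivity

/-- The polynomial equation, in terms of the variable `s / (1 + s)`. -/
theorem rootEquation_iff (d : ℕ) {s : ℝ} (hs : 0 < s) :
    2 ^ d * s ^ (d + 1) - (1 + s) ^ (d + 1) + 2 ^ d * ((d : ℝ) + 1) * s ^ d = 0 ↔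
      2 ^ d * (((d : ℝ) + 1) * (s / (1 + s)) ^ d - d * (s / (1 + s)) ^ (d + 1)) = 1 := by
  have h : (0 : ℝ) < 1 + s := by linarith
  have e : 2 ^ d * (((d : ℝ) + 1) * (s / (1 + s)) ^ d - d * (s / (1 + s)) ^ (d + 1)) - 1
      = (2 ^ d * s ^ (d + 1) - (1 + s) ^ (d + 1) + 2 ^ d * ((d : ℝ) + 1) * s ^ d)
        / (1 + s) ^ (d + 1) := by
    rw [div_pow, div_pow]
    field_simp
    ring
  rw [← sub_eq_zero (b := (1 : ℝ)), e, div_eq_zero_iff]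
  constructor
  · exact Or.inl
  · rintro (h' | h')
    · exact h'
    · exact absurd h' (by positivity)

theorem existsUnique_root (d : ℕ) (hd : 1 ≤ d) :
    ∃! s : ℝ, s ∈ Set.Ioo (0 : ℝ) 1 ∧
      2 ^ d * s ^ (d + 1) - (1 + s) ^ (d + 1) + 2 ^ d * ((d : ℝ) + 1) * s ^ d = 0 := by
  have hd0 : (1 : ℝ) ≤ d := by exact_mod_cast hd
  have hex : (0 : ℝ) ∈ (fun s : ℝ => 2 ^ d * s ^ (d + 1) - (1 + s) ^ (d + 1)
      + 2 ^ d * ((d : ℝ) + 1) * s ^ d) '' Ioo 0 1 := by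
    apply intermediate_value_Ioo (by norm_num) (by fun_prop)
    constructor
    · have : (0 : ℝ) ^ d = 0 := zero_pow (by omega)
      simp [this]
    · have : (0 : ℝ) < 2 ^ d * d := by positivity
      simp only [one_pow, mul_one]
      norm_num
      ring_nf
      linarith
  obtain ⟨s, hs, hs0⟩ := hex
  refine ⟨s, ⟨hs, hs0⟩, ?_⟩
  rintro u ⟨hu, hu0⟩
  have h1 := (rootEquation_iff d hs.1).1 hs0
  have h2 := (rootEquation_iff d hu.1).1 hu0
  have mem : ∀ v ∈ Ioo (0 : ℝ) 1, v / (1 + v) ∈ Icc (0 : ℝ) 1 := fun v hv =>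
    ⟨div_nonneg hv.1.le (by linarith [hv.1]), (div_le_one (by linarith [hv.1])).2 (by linarith)⟩
  have h3 := (strictMonoOn_add_one_mul_pow_sub d hd).injOn (mem u hu) (mem s hs)
    (mul_left_cancel₀ (by positivity : (2 : ℝ) ^ d ≠ 0) (h2.trans h1.symm))
  have hs1 : 1 + s ≠ 0 := by linarith [hs.1]
  have hu1 : 1 + u ≠ 0 := by linarith [hu.1]
  rw [div_eq_div_iff hu1 hs1] at h3
  linarith

/-- The function `h_d`. -/
noncomputable def cubeMean (d : ℕ) (s : ℝ) : ℝ :=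
  (d : ℝ) / (d + 1) - (1 / (d + 1)) * (s - 2 ^ d * s ^ (d + 1) / (1 + s) ^ d)

theorem tangent_le_two_pow_mul_div (d : ℕ) {s u : ℝ} (hs : 0 < s) (hu : 0 ≤ u) :
    2 ^ d * (((d : ℝ) + 1) * (s / (1 + s)) ^ d * u - d * (s / (1 + s)) ^ (d + 1) * (1 + u)) ≤
      2 ^ d * u ^ (d + 1) / (1 + u) ^ d := by
  have h1 : 0 < 1 + u := by linarith
  have h := add_one_mul_pow_mul_le d (w := u / (1 + u)) (t := s / (1 + s))
    (by positivity) (by positivity)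
  have h' := mul_le_mul_of_nonneg_right h h1.le
  have e1 : ((d : ℝ) + 1) * (s / (1 + s)) ^ d * (u / (1 + u)) * (1 + u)
      = ((d : ℝ) + 1) * (s / (1 + s)) ^ d * u := by field_simp
  have e2 : (u / (1 + u)) ^ (d + 1) * (1 + u) = u ^ (d + 1) / (1 + u) ^ d := by
    rw [div_pow, pow_succ (1 + u)]; field_simp
  rw [e1, add_mul ((u / (1 + u)) ^ (d + 1)), e2] at h'
  rw [mul_div_assoc]
  gcongr
  linarith

/-- The root of the polynomial equation minimizes `h_d`. -/
theorem cubeMean_root_le (d : ℕ) {s u : ℝ} (hs : 0 < s) (hu : 0 ≤ u)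
    (h0 : 2 ^ d * s ^ (d + 1) - (1 + s) ^ (d + 1) + 2 ^ d * ((d : ℝ) + 1) * s ^ d = 0) :
    cubeMean d s ≤ cubeMean d u := by
  have h := tangent_le_two_pow_mul_div d hs hu
  have hq := (rootEquation_iff d hs).1 h0
  have hs1 : 0 < 1 + s := by linarith
  have e : 2 ^ d * s ^ (d + 1) / (1 + s) ^ d
      = s - 2 ^ d * d * (s / (1 + s)) ^ (d + 1) := by
    have e2 : 2 ^ d * s ^ (d + 1) / (1 + s) ^ d
        = 2 ^ d * ((s / (1 + s)) ^ (d + 1) * (1 + s)) := by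
      rw [div_pow, pow_succ (1 + s)]; field_simp
    have e3 : (s / (1 + s)) ^ (d + 1) * (1 + s) = (s / (1 + s)) ^ d * s := by
      rw [pow_succ]; field_simp
    linear_combination e2 + s * hq + 2 ^ d * ((d : ℝ) + 1) * e3
  unfold cubeMean
  have hk : s - 2 ^ d * s ^ (d + 1) / (1 + s) ^ d ≥ u - 2 ^ d * u ^ (d + 1) / (1 + u) ^ d := by
    rw [e]
    have hqu : 2 ^ d * (((d : ℝ) + 1) * (s / (1 + s)) ^ d * u
        - d * (s / (1 + s)) ^ (d + 1) * u) = u := by linear_combination u * hq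
    linarith
  gcongr

theorem cubeMean_zero (d : ℕ) : cubeMean d 0 = (d : ℝ) / (d + 1) := by
  simp [cubeMean]

theorem cubeMean_nonneg (d : ℕ) (hd : 1 ≤ d) {s : ℝ} (hs : s ∈ Ioo (0 : ℝ) 1) :
    0 ≤ cubeMean d s := by
  have hd0 : (1 : ℝ) ≤ d := by exact_mod_cast hd
  have h1 : 0 ≤ 2 ^ d * s ^ (d + 1) / (1 + s) ^ d := by
    have := hs.1
    positivity
  have e : cubeMean d s = (d - (s - 2 ^ d * s ^ (d + 1) / (1 + s) ^ d)) / (d + 1) := by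
    unfold cubeMean
    ring
  rw [e]
  exact div_nonneg (by linarith [hs.2]) (by positivity)

end Polynomial

section Cubes

variable {d : ℕ}

theorem volume_real_closedBall_pi (c : Fin d → ℝ) {R : ℝ} (hR : 0 ≤ R) :
    volume.real (Metric.closedBall c R) = (2 * R) ^ d := by
  rw [Measure.real, Real.volume_pi_closedBall c hR, ENNReal.toReal_ofReal (by positivity),
    Fintype.card_fin]

theorem volume_real_closedBall_inter (c : Fin d → ℝ) {R r : ℝ} (hR : 0 ≤ R) (hr : 0 ≤ r) :
    volume.real (Metric.closedBall c R ∩ Metric.closedBall 0 r) =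
      ∏ i, max (min (c i + R) r - max (c i - R) (-r)) 0 := by
  rw [closedBall_pi c hR, closedBall_pi 0 hr, ← Set.pi_inter_distrib, Measure.real,
    volume_pi_pi, ENNReal.toReal_prod]
  refine Finset.prod_congr rfl fun i _ => ?_
  rw [Real.closedBall_eq_Icc, Real.closedBall_eq_Icc, Icc_inter_Icc, Real.volume_Icc,
    ENNReal.toReal_ofReal']
  simp

/-- The tent function `z ↦ (1 - ‖z‖)⁺`. -/
noncomputable def tent (z : Fin d → ℝ) : ℝ := max (1 - ‖z‖) 0

theorem continuous_tent : Continuous (tent : (Fin d → ℝ) → ℝ) := by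
  unfold tent
  fun_prop

theorem setIntegral_tent (c : Fin d → ℝ) {R : ℝ} (hR : 0 ≤ R) :
    ∫ z in Metric.closedBall c R, tent z =
      ∫ r in (0 : ℝ)..1, ∏ i, max (min (c i + R) r - max (c i - R) (-r)) 0 := by
  have hint : Integrable tent (volume.restrict (Metric.closedBall c R)) :=
    continuous_tent.continuousOn.integrableOn_compact (isCompact_closedBall c R)
  rw [hint.integral_eq_integral_Ioc_meas_le (M := 1)
    (Eventually.of_forall fun z => le_max_right _ _)
    (Eventually.of_forall fun z => max_le (by linarith [norm_nonneg z]) zero_le_one)]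
  have hsub := intervalIntegral.integral_comp_sub_left (a := 0) (b := 1)
    (fun r => ∏ i, max (min (c i + R) r - max (c i - R) (-r)) 0) 1
  rw [sub_self, sub_zero] at hsub
  rw [← hsub, intervalIntegral.integral_of_le zero_le_one]
  refine setIntegral_congr_fun measurableSet_Ioc fun t ht => ?_
  have hset : {z : Fin d → ℝ | t ≤ tent z} = Metric.closedBall 0 (1 - t) := by
    ext z
    rw [mem_closedBall_zero_iff, mem_ofPred_eq, tent, le_max_iff]
    constructor
    · rintro (h | h)
      · linarith
      · linarith [ht.1]
    · intro h
      left
      linarith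
  rw [hset, measureReal_restrict_apply Metric.isClosed_closedBall.measurableSet, inter_comm,
    volume_real_closedBall_inter c hR (by linarith [ht.2])]

theorem integral_min_pow (d : ℕ) {s : ℝ} (hs : s ∈ Icc (0 : ℝ) 1) :
    ∫ r in (0 : ℝ)..1, (r + min s r) ^ d = (1 - cubeMean d s) * (1 + s) ^ d := by
  have hcont : Continuous fun r : ℝ => (r + min s r) ^ d := by fun_prop
  rw [← intervalIntegral.integral_add_adjacent_intervals (hcont.intervalIntegrable 0 s)
    (hcont.intervalIntegrable s 1)]
  have h1 : ∫ r in (0 : ℝ)..s, (r + min s r) ^ d = ∫ r in (0 : ℝ)..s, 2 ^ d * r ^ d := by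
    refine intervalIntegral.integral_congr fun r hr => ?_
    rw [uIcc_of_le hs.1] at hr
    rw [min_eq_right hr.2, ← two_mul, mul_pow]
  have h2 : ∫ r in s..1, (r + min s r) ^ d = ∫ r in s..1, (r + s) ^ d := by
    refine intervalIntegral.integral_congr fun r hr => ?_
    rw [uIcc_of_le hs.2] at hr
    rw [min_eq_left hr.1]
  rw [h1, h2, intervalIntegral.integral_const_mul, integral_pow,
    intervalIntegral.integral_comp_add_right (fun r => r ^ d), integral_pow]
  have : 0 < 1 + s := by linarith [hs.1]
  unfold cubeMean
  field_simp
  ring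

theorem setAverage_closedBall_eq (g : (Fin d → ℝ) → ℝ) (c : Fin d → ℝ) {R : ℝ} (hR : 0 < R) :
    ⨍ z in Metric.closedBall c R, g z =
      ⨍ v in Metric.closedBall (0 : Fin d → ℝ) 1, g (c + R • v) := by
  have h1 := (measurePreserving_add_left (volume : Measure (Fin d → ℝ)) c).setIntegral_preimage_emb
    (measurableEmbedding_addLeft c) g (Metric.closedBall c R)
  have hpre : (fun z => c + z) ⁻¹' Metric.closedBall c R = Metric.closedBall 0 R := by
    ext z
    simp
  rw [hpre] at h1
  have h2 := Measure.setIntegral_comp_smul_of_pos (volume : Measure (Fin d → ℝ))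
    (fun z => g (c + z)) (Metric.closedBall 0 1) hR
  rw [smul_unitClosedBall_of_nonneg hR.le, h1, Module.finrank_fin_fun] at h2
  rw [setAverage_eq, setAverage_eq, h2, volume_real_closedBall_pi c hR.le,
    volume_real_closedBall_pi 0 zero_le_one, smul_smul]
  congr 1
  rw [mul_pow, mul_one]
  field_simp

theorem setAverage_tent_corner {s : ℝ} (hs : s ∈ Icc (0 : ℝ) 1) (σ : Fin d → ℝ)
    (hσ : ∀ i, σ i = 1 ∨ σ i = -1) :
    ⨍ z in Metric.closedBall (fun i => σ i * ((1 - s) / 2)) ((1 + s) / 2), tent z =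
      1 - cubeMean d s := by
  have h1 : 0 < 1 + s := by linarith [hs.1]
  rw [setAverage_eq, volume_real_closedBall_pi _ (by linarith), setIntegral_tent _ (by linarith)]
  have : ∫ r in (0 : ℝ)..1, ∏ i, max (min (σ i * ((1 - s) / 2) + (1 + s) / 2) r
      - max (σ i * ((1 - s) / 2) - (1 + s) / 2) (-r)) 0 = ∫ r in (0 : ℝ)..1, (r + min s r) ^ d := by
    refine intervalIntegral.integral_congr fun r hr => ?_
    rw [uIcc_of_le zero_le_one] at hr
    refine (Finset.prod_congr rfl fun i _ => ?_).trans (Fin.prod_const d (r + min s r))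
    have hn : -min s r = max (-s) (-r) := (max_neg_neg s r).symm
    have h0 : 0 ≤ min s r := le_min hs.1 hr.1
    rcases hσ i with h | h
    · rw [h, show (1 : ℝ) * ((1 - s) / 2) + (1 + s) / 2 = 1 by ring,
        show (1 : ℝ) * ((1 - s) / 2) - (1 + s) / 2 = -s by ring, min_eq_right hr.2, ← hn,
        max_eq_left (by linarith [hr.1])]
      ring
    · rw [h, show (-1 : ℝ) * ((1 - s) / 2) + (1 + s) / 2 = s by ring,
        show (-1 : ℝ) * ((1 - s) / 2) - (1 + s) / 2 = -1 by ring,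
        max_eq_right (by linarith [hr.2] : (-1 : ℝ) ≤ -r), max_eq_left (by linarith [hr.1])]
      ring
  rw [this, integral_min_pow d hs, smul_eq_mul, mul_div_cancel₀ _ two_ne_zero]
  field_simp

/-- Among the cubes containing the corner `(1, …, 1)`, the largest mean of the tent is attained
at `[-s, 1]^d` with `s` the root of the polynomial equation. -/
theorem setAverage_tent_le {s : ℝ} (hs : s ∈ Ioo (0 : ℝ) 1)
    (h0 : 2 ^ d * s ^ (d + 1) - (1 + s) ^ (d + 1) + 2 ^ d * ((d : ℝ) + 1) * s ^ d = 0)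
    (c : Fin d → ℝ) {R : ℝ} (hR : 0 < R) (hc : ∀ i, |1 - c i| ≤ R) :
    ⨍ z in Metric.closedBall c R, tent z ≤ 1 - cubeMean d s := by
  rw [setAverage_eq, volume_real_closedBall_pi c hR.le, setIntegral_tent c hR.le, smul_eq_mul,
    inv_mul_le_iff₀ (by positivity), mul_comm]
  have key : ∀ F : ℝ → ℝ, Continuous F →
      (∀ r ∈ Icc (0 : ℝ) 1, 0 ≤ F r ∧ (min (2 * r) (r + 2 * R - 1) ≤ F r)) →
      ∫ r in (0 : ℝ)..1, ∏ i, max (min (c i + R) r - max (c i - R) (-r)) 0 ≤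
        ∫ r in (0 : ℝ)..1, (F r) ^ d := by
    intro F hF hle
    refine intervalIntegral.integral_mono_on zero_le_one
      (Continuous.intervalIntegrable (by fun_prop) _ _)
      (Continuous.intervalIntegrable (by fun_prop) _ _) fun r hr => ?_
    calc _ ≤ ∏ _i : Fin d, F r := by
          refine Finset.prod_le_prod (fun i _ => le_max_right _ _) fun i _ => ?_
          refine max_le (le_trans ?_ (hle r hr).2) (hle r hr).1
          have := abs_le.1 (hc i)
          refine le_min ?_ ?_
          · linarith [min_le_right (c i + R) r, le_max_right (c i - R) (-r)]
          · linarith [min_le_right (c i + R) r, le_max_left (c i - R) (-r)]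
      _ = F r ^ d := by simp
  by_cases hR1 : 1 ≤ 2 * R ∧ 2 * R ≤ 2
  · have hu : 2 * R - 1 ∈ Icc (0 : ℝ) 1 := ⟨by linarith, by linarith⟩
    refine (key (fun r => r + min (2 * R - 1) r) (by fun_prop) fun r hr => ⟨?_, ?_⟩).trans ?_
    · linarith [le_min hu.1 hr.1, hr.1]
    · rcases le_total (2 * R - 1) r with h | h
      · rw [min_eq_left h]
        exact (min_le_right _ _).trans (by linarith)
      · rw [min_eq_right h]
        exact (min_le_left _ _).trans (by linarith)
    · rw [integral_min_pow d hu, show 1 + (2 * R - 1) = 2 * R by ring]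
      have := cubeMean_root_le d hs.1 hu.1 h0
      gcongr
  · refine (key (fun r => 2 * R * r) (by fun_prop) fun r hr => ⟨?_, ?_⟩).trans ?_
    · have := hr.1
      positivity
    · rcases lt_or_ge (2 * R) 1 with h | h
      · refine (min_le_right _ _).trans ?_
        nlinarith [hr.2]
      · refine (min_le_left _ _).trans ?_
        have : 2 < 2 * R := not_le.1 fun h' => hR1 ⟨h, h'⟩
        nlinarith [hr.1]
    · simp only [mul_pow _ (_ : ℝ) d]
      have := cubeMean_root_le d hs.1 le_rfl h0
      rw [cubeMean_zero] at this
      rw [intervalIntegral.integral_const_mul, integral_pow, mul_comm]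
      gcongr
      have e : (1 : ℝ) - d / (d + 1) = 1 / (d + 1) := by field_simp; ring
      simp only [one_pow, ne_eq, Nat.succ_ne_zero, not_false_eq_true, zero_pow, sub_zero]
      linarith

end Cubes

section MaximalFunction

variable {d : ℕ}

/-- The set of means of `|f|` over the cubes containing `x`. -/
def cubeMeans (f : (Fin d → ℝ) → ℝ) (x : Fin d → ℝ) : Set ℝ :=
  {a | ∃ c : Fin d → ℝ, ∃ R : ℝ, 0 < R ∧ x ∈ Metric.closedBall c R ∧
    a = ⨍ y in Metric.closedBall c R, |f y|}

theorem maxFn_norm_eq (f : (Fin d → ℝ) → ℝ) (x : Fin d → ℝ) :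
    maxFn (fun x => ‖x‖) f x = sSup (cubeMeans f x) := by
  have : ∀ (c : Fin d → ℝ) (R : ℝ), nball (fun x => ‖x‖) c R = Metric.closedBall c R := by
    intro c R
    ext y
    simp [nball, dist_eq_norm]
  simp only [maxFn, cubeMeans, this]

theorem cubeMeans_nonempty (f : (Fin d → ℝ) → ℝ) (x : Fin d → ℝ) : (cubeMeans f x).Nonempty :=
  ⟨_, x, 1, one_pos, Metric.mem_closedBall_self zero_le_one, rfl⟩

theorem volume_cube_ne_zero : volume (Metric.closedBall (0 : Fin d → ℝ) 1) ≠ 0 :=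
  (Metric.measure_closedBall_pos volume _ one_pos).ne'

theorem setAverage_mono_cube {F G : (Fin d → ℝ) → ℝ} (hF : Continuous F) (hG : Continuous G)
    (h : ∀ v ∈ Metric.closedBall (0 : Fin d → ℝ) 1, F v ≤ G v) :
    ⨍ v in Metric.closedBall (0 : Fin d → ℝ) 1, F v ≤
      ⨍ v in Metric.closedBall (0 : Fin d → ℝ) 1, G v := by
  rw [setAverage_eq, setAverage_eq]
  refine smul_le_smul_of_nonneg_left ?_ (inv_nonneg.2 measureReal_nonneg)
  exact setIntegral_mono_on (hF.continuousOn.integrableOn_compact (isCompact_closedBall _ _))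
    (hG.continuousOn.integrableOn_compact (isCompact_closedBall _ _))
    Metric.isClosed_closedBall.measurableSet h

theorem setAverage_cube_add {F G : (Fin d → ℝ) → ℝ} (hF : Continuous F) (hG : Continuous G) :
    ⨍ v in Metric.closedBall (0 : Fin d → ℝ) 1, (F v + G v) =
      (⨍ v in Metric.closedBall (0 : Fin d → ℝ) 1, F v) +
        ⨍ v in Metric.closedBall (0 : Fin d → ℝ) 1, G v := by
  rw [setAverage_eq, setAverage_eq, setAverage_eq, integral_add
    (hF.continuousOn.integrableOn_compact (isCompact_closedBall _ _))
    (hG.continuousOn.integrableOn_compact (isCompact_closedBall _ _)), smul_add]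

theorem setAverage_cube_const_mul (F : (Fin d → ℝ) → ℝ) (a : ℝ) :
    ⨍ v in Metric.closedBall (0 : Fin d → ℝ) 1, a * F v =
      a * ⨍ v in Metric.closedBall (0 : Fin d → ℝ) 1, F v := by
  rw [setAverage_eq, setAverage_eq, integral_const_mul, smul_eq_mul, smul_eq_mul]
  ring

theorem setAverage_cube_const (a : ℝ) :
    ⨍ _v in Metric.closedBall (0 : Fin d → ℝ) 1, a = a :=
  setAverage_const volume_cube_ne_zero measure_closedBall_lt_top.ne a

/-- The mean displacement when a cube is expanded by `1` on one side and by `s` on the other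
side, in every coordinate. -/
theorem setAverage_norm_displacement {s : ℝ} (hs : s ∈ Icc (0 : ℝ) 1) (σ : Fin d → ℝ)
    (hσ : ∀ i, σ i = 1 ∨ σ i = -1) :
    ⨍ v in Metric.closedBall (0 : Fin d → ℝ) 1,
      ‖(fun i => σ i * ((1 - s) / 2)) + ((1 + s) / 2) • v‖ = cubeMean d s := by
  set b : Fin d → ℝ := fun i => σ i * ((1 - s) / 2) with hb
  have h1 : 0 < (1 + s) / 2 := by linarith [hs.1]
  have ht := setAverage_tent_corner hs σ hσ
  rw [setAverage_closedBall_eq _ _ h1] at ht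
  have hc1 : Continuous fun v : Fin d → ℝ => ‖b + ((1 + s) / 2) • v‖ := by fun_prop
  have hc2 : Continuous fun v : Fin d → ℝ => tent (b + ((1 + s) / 2) • v) :=
    continuous_tent.comp (by fun_prop)
  have hadd := setAverage_cube_add hc1 hc2
  have hone : ⨍ v in Metric.closedBall (0 : Fin d → ℝ) 1,
      (‖b + ((1 + s) / 2) • v‖ + tent (b + ((1 + s) / 2) • v)) = 1 := by
    have hle : ∀ v ∈ Metric.closedBall (0 : Fin d → ℝ) 1, ‖b + ((1 + s) / 2) • v‖ ≤ 1 := by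
      intro v hv
      rw [mem_closedBall_zero_iff] at hv
      have hbn : ‖b‖ ≤ (1 - s) / 2 := by
        refine (pi_norm_le_iff_of_nonneg (by linarith [hs.2])).2 fun i => ?_
        have : |σ i| = 1 := by rcases hσ i with h | h <;> simp [h]
        rw [hb, Real.norm_eq_abs, abs_mul, this, abs_of_nonneg (by linarith [hs.2])]
        linarith
      calc ‖b + ((1 + s) / 2) • v‖ ≤ ‖b‖ + ‖((1 + s) / 2) • v‖ := norm_add_le _ _
        _ ≤ (1 - s) / 2 + (1 + s) / 2 * 1 := by
          rw [norm_smul, Real.norm_eq_abs, abs_of_pos h1]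
          gcongr
        _ = 1 := by ring
    have hc : ∀ v ∈ Metric.closedBall (0 : Fin d → ℝ) 1,
        ‖b + ((1 + s) / 2) • v‖ + tent (b + ((1 + s) / 2) • v) = 1 := by
      intro v hv
      rw [tent, max_eq_left (by linarith [hle v hv])]
      ring
    refine (le_antisymm ?_ ?_).trans (setAverage_cube_const (d := d) 1)
    · exact setAverage_mono_cube (hc1.add hc2) continuous_const fun v hv => (hc v hv).le
    · exact setAverage_mono_cube continuous_const (hc1.add hc2) fun v hv => (hc v hv).ge
  rw [hone] at hadd
  linarith

theorem exists_cubeMeans_ge {f : (Fin d → ℝ) → ℝ} (hf : ∀ x y, |f x - f y| ≤ ‖x - y‖)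
    (hfc : Continuous f) {s : ℝ} (hs : s ∈ Icc (0 : ℝ) 1) (x y : Fin d → ℝ) {a : ℝ}
    (ha : a ∈ cubeMeans f x) :
    ∃ b ∈ cubeMeans f y, a ≤ b + cubeMean d s * ‖x - y‖ := by
  obtain ⟨c, R, hR, hx, rfl⟩ := ha
  set δ := ‖x - y‖ with hδ
  have hδ0 : 0 ≤ δ := norm_nonneg _
  have hs0 := hs.1
  set σ : Fin d → ℝ := fun i => if x i ≤ y i then 1 else -1 with hσ
  have hσ1 : ∀ i, σ i = 1 ∨ σ i = -1 := by
    intro i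
    by_cases h : x i ≤ y i <;> simp [hσ, h]
  set b : Fin d → ℝ := fun i => σ i * ((1 - s) / 2) with hb
  have hR' : 0 < R + δ * ((1 + s) / 2) := by positivity
  refine ⟨_, ⟨c + δ • b, R + δ * ((1 + s) / 2), hR', ?_, rfl⟩, ?_⟩
  · rw [Metric.mem_closedBall, dist_pi_le_iff hR'.le] at *
    intro i
    rw [dist_pi_le_iff hR.le] at hx
    have h1 := abs_le.1 (Real.dist_eq (x i) (c i) ▸ hx i)
    have h2 : |x i - y i| ≤ δ := by
      simpa using norm_le_pi_norm (x - y) i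
    have h3 := abs_le.1 h2
    rw [Real.dist_eq, abs_le]
    by_cases h : x i ≤ y i
    · simp only [hb, hσ, h, Pi.add_apply, Pi.smul_apply, if_true, smul_eq_mul]
      constructor <;> nlinarith [mul_nonneg hδ0 hs0]
    · simp only [hb, hσ, h, Pi.add_apply, Pi.smul_apply, if_false, smul_eq_mul]
      constructor <;> nlinarith [mul_nonneg hδ0 hs0]
  · rw [setAverage_closedBall_eq _ _ hR, setAverage_closedBall_eq _ _ hR',
      ← setAverage_norm_displacement hs σ hσ1, mul_comm _ δ, ← setAverage_cube_const_mul,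
      ← setAverage_cube_add (by fun_prop) (by fun_prop)]
    refine setAverage_mono_cube (by fun_prop) (by fun_prop) fun v _ => ?_
    have h1 := (abs_sub_abs_le_abs_sub _ _).trans
      (hf (c + R • v) (c + δ • b + (R + δ * ((1 + s) / 2)) • v))
    have h2 : c + R • v - (c + δ • b + (R + δ * ((1 + s) / 2)) • v)
        = -(δ • (b + ((1 + s) / 2) • v)) := by
      module
    rw [h2, norm_neg, norm_smul, Real.norm_eq_abs, abs_of_nonneg hδ0] at h1
    linarith

theorem abs_maxFn_sub_le {f : (Fin d → ℝ) → ℝ} (hf : ∀ x y, |f x - f y| ≤ ‖x - y‖)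
    (hfc : Continuous f) {s : ℝ} (hs : s ∈ Icc (0 : ℝ) 1) (hh : 0 ≤ cubeMean d s)
    (x y : Fin d → ℝ) :
    |maxFn (fun x => ‖x‖) f x - maxFn (fun x => ‖x‖) f y| ≤ cubeMean d s * ‖x - y‖ := by
  simp only [maxFn_norm_eq]
  have bdd : ∀ x y, BddAbove (cubeMeans f y) → BddAbove (cubeMeans f x) := by
    rintro x y ⟨M, hM⟩
    refine ⟨M + cubeMean d s * ‖x - y‖, fun a ha => ?_⟩
    obtain ⟨b, hb, hab⟩ := exists_cubeMeans_ge hf hfc hs x y ha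
    linarith [hM hb]
  have le : ∀ x y, BddAbove (cubeMeans f y) →
      sSup (cubeMeans f x) ≤ sSup (cubeMeans f y) + cubeMean d s * ‖x - y‖ := by
    intro x y hy
    refine csSup_le (cubeMeans_nonempty f x) fun a ha => ?_
    obtain ⟨b, hb, hab⟩ := exists_cubeMeans_ge hf hfc hs x y ha
    linarith [le_csSup hy hb]
  by_cases hb : BddAbove (cubeMeans f x)
  · have h1 := le x y (bdd y x hb)
    have h2 := le y x hb
    rw [norm_sub_rev] at h2
    exact abs_le.2 ⟨by linarith, by linarith⟩
  · have hb' : ¬ BddAbove (cubeMeans f y) := fun h => hb (bdd x y h)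
    rw [Real.sSup_of_not_bddAbove hb, Real.sSup_of_not_bddAbove hb', sub_self, abs_zero]
    positivity

end MaximalFunction

section Hoelder

variable {d : ℕ}

theorem div_norm_rpow_one_le {g : (Fin d → ℝ) → ℝ} {L : ℝ}
    (hg : ∀ x y, |g x - g y| ≤ L * ‖x - y‖) {a : ℝ}
    (ha : a ∈ {a : ℝ | ∃ x y : Fin d → ℝ, x ≠ y ∧ a = |g x - g y| / ‖x - y‖ ^ (1 : ℝ)}) :
    a ≤ L := by
  obtain ⟨x, y, hxy, rfl⟩ := ha
  rw [Real.rpow_one, div_le_iff₀ (norm_sub_pos_iff.2 hxy)]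
  exact hg x y

theorem holderNorm_le {g : (Fin d → ℝ) → ℝ} {L : ℝ} (hL : 0 ≤ L)
    (hg : ∀ x y, |g x - g y| ≤ L * ‖x - y‖) : holderNorm (fun x => ‖x‖) 1 g ≤ L :=
  Real.sSup_le (fun _ ha => div_norm_rpow_one_le hg ha) hL

theorem le_holderNorm {g : (Fin d → ℝ) → ℝ} {L : ℝ} (hg : ∀ x y, |g x - g y| ≤ L * ‖x - y‖)
    {x y : Fin d → ℝ} (hxy : ‖x - y‖ = 1) : |g x - g y| ≤ holderNorm (fun x => ‖x‖) 1 g := by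
  refine le_csSup ⟨L, fun _ ha => div_norm_rpow_one_le hg ha⟩ ⟨x, y, ?_, ?_⟩
  · rintro rfl
    simp at hxy
  · simp [hxy]

theorem abs_sub_le_of_holderNorm_eq_one {f : (Fin d → ℝ) → ℝ}
    (hf : holderNorm (fun x => ‖x‖) 1 f = 1) (x y : Fin d → ℝ) : |f x - f y| ≤ ‖x - y‖ := by
  rcases eq_or_ne x y with rfl | hxy
  · simp
  have hb : BddAbove {a : ℝ | ∃ x y : Fin d → ℝ, x ≠ y ∧
      a = |f x - f y| / ‖x - y‖ ^ (1 : ℝ)} := by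
    by_contra h
    have := Real.sSup_of_not_bddAbove h
    rw [holderNorm] at hf
    linarith
  have h := le_csSup hb ⟨x, y, hxy, rfl⟩
  rw [holderNorm] at hf
  rw [hf, Real.rpow_one, div_le_one (norm_sub_pos_iff.2 hxy)] at h
  exact h

theorem continuous_of_abs_sub_le {f : (Fin d → ℝ) → ℝ} (hf : ∀ x y, |f x - f y| ≤ ‖x - y‖) :
    Continuous f :=
  (LipschitzWith.of_dist_le_mul (K := 1) fun x y => by
    simpa [dist_eq_norm] using hf x y).continuous

theorem holderNorm_maxFn_le {f : (Fin d → ℝ) → ℝ} (hf : holderNorm (fun x => ‖x‖) 1 f = 1)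
    {s : ℝ} (hs : s ∈ Icc (0 : ℝ) 1) (hh : 0 ≤ cubeMean d s) :
    holderNorm (fun x => ‖x‖) 1 (maxFn (fun x => ‖x‖) f) ≤ cubeMean d s :=
  have hf' := abs_sub_le_of_holderNorm_eq_one hf
  holderNorm_le hh (abs_maxFn_sub_le hf' (continuous_of_abs_sub_le hf') hs hh)

theorem abs_tent_sub_le (x y : Fin d → ℝ) : |tent x - tent y| ≤ ‖x - y‖ := by
  refine (abs_max_sub_max_le_abs _ _ _).trans ?_
  rw [sub_sub_sub_cancel_left, abs_sub_comm]
  exact abs_norm_sub_norm_le x y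

theorem norm_const_one (hd : 1 ≤ d) : ‖(fun _ => 1 : Fin d → ℝ)‖ = 1 := by
  have : Nonempty (Fin d) := ⟨⟨0, hd⟩⟩
  rw [pi_norm_const, norm_one]

theorem holderNorm_tent (hd : 1 ≤ d) :
    holderNorm (fun x => ‖x‖) 1 (tent : (Fin d → ℝ) → ℝ) = 1 := by
  have hL : ∀ x y : Fin d → ℝ, |tent x - tent y| ≤ 1 * ‖x - y‖ := by
    simpa using abs_tent_sub_le
  refine le_antisymm (holderNorm_le zero_le_one hL) ?_
  have h := le_holderNorm hL (x := 0) (y := fun _ => 1)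
    (by rw [zero_sub, norm_neg, norm_const_one hd])
  simpa [tent, norm_const_one hd] using h

theorem abs_tent (z : Fin d → ℝ) : |tent z| = tent z := abs_of_nonneg (le_max_right _ _)

theorem one_le_maxFn_tent_zero :
    1 ≤ maxFn (fun x => ‖x‖) (tent : (Fin d → ℝ) → ℝ) 0 := by
  rw [maxFn_norm_eq]
  have hb : BddAbove (cubeMeans (tent : (Fin d → ℝ) → ℝ) 0) := by
    refine ⟨1, ?_⟩
    rintro _ ⟨c, R, hR, -, rfl⟩
    simp only [abs_tent]
    rw [setAverage_closedBall_eq _ _ hR]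
    refine (setAverage_mono_cube (continuous_tent.comp (by fun_prop)) continuous_const
      fun v _ => ?_).trans (setAverage_cube_const 1).le
    exact max_le (by linarith [norm_nonneg (c + R • v)]) zero_le_one
  refine le_of_forall_pos_le_add fun ε hε => ?_
  have h := le_csSup hb ⟨0, ε, hε, Metric.mem_closedBall_self hε.le, rfl⟩
  have h2 : 1 - ε ≤ ⨍ y in Metric.closedBall (0 : Fin d → ℝ) ε, |tent y| := by
    simp only [abs_tent]
    rw [setAverage_closedBall_eq _ _ hε]
    refine (setAverage_cube_const (d := d) (1 - ε)).ge.trans (setAverage_mono_cube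
      continuous_const (continuous_tent.comp (by fun_prop)) fun v hv => ?_)
    rw [mem_closedBall_zero_iff] at hv
    refine le_trans ?_ (le_max_left _ _)
    rw [zero_add, norm_smul, Real.norm_eq_abs, abs_of_pos hε]
    nlinarith
  linarith

theorem maxFn_tent_one_le {s : ℝ} (hs : s ∈ Ioo (0 : ℝ) 1)
    (h0 : 2 ^ d * s ^ (d + 1) - (1 + s) ^ (d + 1) + 2 ^ d * ((d : ℝ) + 1) * s ^ d = 0) :
    maxFn (fun x => ‖x‖) (tent : (Fin d → ℝ) → ℝ) (fun _ => 1) ≤ 1 - cubeMean d s := by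
  rw [maxFn_norm_eq]
  refine csSup_le (cubeMeans_nonempty _ _) ?_
  rintro _ ⟨c, R, hR, hc, rfl⟩
  simp only [abs_tent]
  refine setAverage_tent_le hs h0 c hR fun i => ?_
  rw [Metric.mem_closedBall, dist_pi_le_iff hR.le] at hc
  exact hc i

end Hoelder

/-- The operator norm of the maximal operator associated to `ℓ∞` balls on Lipschitz
functions of `(ℝ^d, ‖·‖_∞)` is obtained by evaluating
`h_d(s) = d/(d+1) − (1/(d+1))(s − 2^d s^{d+1}/(1+s)^d)` at the unique root in `(0,1)` of
`2^d s^{d+1} − (1+s)^{d+1} + 2^d (d+1) s^d = 0`. -/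
theorem stmt10 (d : ℕ) (hd : 1 ≤ d) :
    (∃! s : ℝ, s ∈ Set.Ioo (0 : ℝ) 1 ∧
      2 ^ d * s ^ (d + 1) - (1 + s) ^ (d + 1) + 2 ^ d * ((d : ℝ) + 1) * s ^ d = 0) ∧
    ∀ s ∈ Set.Ioo (0 : ℝ) 1,
      2 ^ d * s ^ (d + 1) - (1 + s) ^ (d + 1) + 2 ^ d * ((d : ℝ) + 1) * s ^ d = 0 →
      opNormHolder d (fun x => ‖x‖) 1 =
        (d : ℝ) / (d + 1) - (1 / (d + 1)) * (s - 2 ^ d * s ^ (d + 1) / (1 + s) ^ d) := by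
  refine ⟨existsUnique_root d hd, fun s hs h0 => ?_⟩
  have hh := cubeMean_nonneg d hd hs
  have hs' := Ioo_subset_Icc_self hs
  have hup : ∀ a ∈ {a : ℝ | ∃ f : (Fin d → ℝ) → ℝ, holderNorm (fun x => ‖x‖) 1 f = 1 ∧
      a = holderNorm (fun x => ‖x‖) 1 (maxFn (fun x => ‖x‖) f)}, a ≤ cubeMean d s := by
    rintro _ ⟨f, hf, rfl⟩
    exact holderNorm_maxFn_le hf hs' hh
  refine le_antisymm (Real.sSup_le hup hh) ?_
  refine le_trans ?_ (le_csSup ⟨_, hup⟩ ⟨tent, holderNorm_tent hd, rfl⟩)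
  refine le_trans ?_ (le_holderNorm (abs_maxFn_sub_le abs_tent_sub_le continuous_tent hs' hh)
    (x := 0) (y := fun _ => 1) (by rw [zero_sub, norm_neg, norm_const_one hd]))
  have h1 := one_le_maxFn_tent_zero (d := d)
  have h2 := maxFn_tent_one_le hs h0
  refine le_trans ?_ (le_abs_self _)
  change cubeMean d s ≤ _
  linarith
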